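/- Let m > 0, let x₊ < 0 be such that A'(x) < 0 for all x ∈ [x₊, 0) and F(r)/(4l²) − F'(r)²/16 ≥ 0 for all r ≥ r(x₊), and let S > 0 satisfy 1/l² + S < A(x₊)². Let x_S be the unique point of (x₊, 0) with A(x_S)² = 1/l² + S, choose A₁ < A₂ with x₊ < A₁ < A₂ < x_S, and set Σ₁ = [x₊, A₁), Σ₂ = [x₊, A₂). Then there exist h₀ > 0, C > 0 and ε > 0 such that for all h ∈ (0, h₀), all E ∈ ℝ with E < 1/l² + S, and all φ ∈ C_c^∞((x₊, 0), ℂ⁴): ‖φ‖_{L²(Σ₁)} ≤ C ( e^{−ε/h} ‖φ‖_{L²(Σ₂)} + ‖ −h² φ'' + V φ − E φ ‖_{L²(Σ₂)} ). -/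

import Mathlib

open MeasureTheory Set Matrix

/-- The metric coefficient `F(r) = 1 - 2M/r + r²/l²`. -/
noncomputable def F (M l r : ℝ) : ℝ := 1 - 2*M/r + r^2/l^2

/-- The derivative `F'(r) = 2M/r² + 2r/l²`. -/
noncomputable def F' (M l r : ℝ) : ℝ := 2*M/r^2 + 2*r/l^2

/-- The potential `A(x) = F(r(x))^{1/2}/r(x)`. -/
noncomputable def A (M l : ℝ) (rfun : ℝ → ℝ) (x : ℝ) : ℝ :=
  Real.sqrt (F M l (rfun x)) / rfun x

/-- The potential `B(x) = F(r(x))^{1/2}`. -/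
noncomputable def B (M l : ℝ) (rfun : ℝ → ℝ) (x : ℝ) : ℝ :=
  Real.sqrt (F M l (rfun x))

/-- The Dirac matrix `γ¹`. -/
noncomputable def γ1 : Matrix (Fin 4) (Fin 4) ℂ :=
  !![0, 0, Complex.I, 0;
     0, 0, 0, -Complex.I;
     Complex.I, 0, 0, 0;
     0, -Complex.I, 0, 0]

/-- The matrix `γ¹γ²`. -/
noncomputable def γ12 : Matrix (Fin 4) (Fin 4) ℂ :=
  !![0, -1, 0, 0;
     1, 0, 0, 0;
     0, 0, 0, -1;
     0, 0, 1, 0]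

/-- The matrix potential
`V(x) = (A² + h²m²B²) I − ih A' γ¹γ² + ih² m B' γ¹`. -/
noncomputable def Vpot (M l : ℝ) (rfun : ℝ → ℝ) (m h x : ℝ) :
    Matrix (Fin 4) (Fin 4) ℂ :=
  (((A M l rfun x)^2 + h^2 * m^2 * (B M l rfun x)^2 : ℝ) : ℂ) • 1
    - (Complex.I * ((h * deriv (A M l rfun) x : ℝ) : ℂ)) • γ12
    + (Complex.I * ((h^2 * m * deriv (B M l rfun) x : ℝ) : ℂ)) • γ1

/-- The squared Hermitian norm `‖u‖² = ∑ |uⱼ|²` on `ℂ⁴`. -/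
noncomputable def nsq (u : Fin 4 → ℂ) : ℝ :=
  ∑ j, Complex.normSq (u j)

/-- The `L²` norm over a set `s ⊆ ℝ` of a `ℂ⁴`-valued function. -/
noncomputable def L2norm (s : Set ℝ) (g : ℝ → Fin 4 → ℂ) : ℝ :=
  Real.sqrt (∫ x in s, nsq (g x))

/-- Pointwise algebraic estimate for the Agmon weight. -/
lemma weight_alg (t s c κ h u u2 g : ℝ) (hh : 0 < h) (hc : c = 16 * κ ^ 2) (hc0 : 0 < c)
    (hu : 0 ≤ u) (hg : 0 ≤ g) (hs0 : 0 < s) (s1 : t < 1) (st : s ≤ t)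
    (i1 : c * u - g / c ≤ h ^ 2 * u2) :
    c / 2 * ((t - s) ^ 2 * u) - c / 2 * s ^ 2 * u - 1 / c * g ≤
      h ^ 2 * (u2 * (t - s) ^ 2 - u * ((κ / h) ^ 2 *
        (2 * (t * (1 - t)) ^ 2 + 2 * (t - s) * (t * (1 - t) * (1 - 2 * t))))) := by
  have s0 : 0 < t := hs0.trans_le st
  have e1 : h ^ 2 * (u2 * (t - s) ^ 2 - u * ((κ / h) ^ 2 *
        (2 * (t * (1 - t)) ^ 2 + 2 * (t - s) * (t * (1 - t) * (1 - 2 * t)))))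
      = (t - s) ^ 2 * (h ^ 2 * u2) - u * (κ ^ 2 *
        (2 * (t * (1 - t)) ^ 2 + 2 * (t - s) * (t * (1 - t) * (1 - 2 * t)))) := by
    field_simp
  have e2 : (t - s) ^ 2 * (c * u - g / c) ≤ (t - s) ^ 2 * (h ^ 2 * u2) := by gcongr
  have e3 : (t - s) ^ 2 * (g / c) ≤ 1 * (g / c) := by
    gcongr
    nlinarith
  have q1 : (t * (1 - t)) ^ 2 ≤ t ^ 2 := by
    have : 0 ≤ t * (1 - t) := mul_nonneg s0.le (by linarith)
    have : t * (1 - t) ≤ t := by nlinarith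
    gcongr
  have q2 : (t - s) * (t * (1 - t) * (1 - 2 * t)) ≤ t ^ 2 := by
    have h1 : (1 - t) * (1 - 2 * t) ≤ 1 := by nlinarith
    have h2 : t * (1 - t) * (1 - 2 * t) ≤ t := by
      have : t * ((1 - t) * (1 - 2 * t)) ≤ t * 1 := by gcongr
      linarith
    have h3 : (t - s) * (t * (1 - t) * (1 - 2 * t)) ≤ (t - s) * t :=
      mul_le_mul_of_nonneg_left h2 (by linarith)
    have h4 : 0 < s * t := mul_pos hs0 s0
    linarith [h3, h4, show (t - s) * t = t ^ 2 - s * t by ring]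
  have q3 : 2 * (t * (1 - t)) ^ 2 + 2 * (t - s) * (t * (1 - t) * (1 - 2 * t)) ≤
      8 * (t - s) ^ 2 + 8 * s ^ 2 := by
    have := sq_nonneg (t - s - s)
    have : 4 * t ^ 2 ≤ 8 * (t - s) ^ 2 + 8 * s ^ 2 := by nlinarith
    linarith
  have q4 : u * (κ ^ 2 * (2 * (t * (1 - t)) ^ 2 + 2 * (t - s) * (t * (1 - t) * (1 - 2 * t)))) ≤
      u * (κ ^ 2 * (8 * (t - s) ^ 2 + 8 * s ^ 2)) := by
    exact mul_le_mul_of_nonneg_left (mul_le_mul_of_nonneg_left q3 (sq_nonneg κ)) hu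
  have q5 : u * (κ ^ 2 * (8 * (t - s) ^ 2 + 8 * s ^ 2)) =
      c / 2 * ((t - s) ^ 2 * u) + c / 2 * s ^ 2 * u := by
    rw [hc]; ring
  have q6 : 1 / c * g = g / c := by ring
  have q7 : (t - s) ^ 2 * (c * u - g / c) = c * ((t - s) ^ 2 * u) - (t - s) ^ 2 * (g / c) := by ring
  rw [e1, q6]
  linarith

/-- Scalar Agmon-type estimate. -/
lemma agmon_core (a A₁ b h c κ : ℝ) (h1 : a < A₁) (h2 : A₁ < b) (hh : 0 < h) (hκ : 0 < κ)
    (hc : c = 16 * κ ^ 2) (hsm : Real.exp (-(κ * (b - A₁)) / h) ≤ 1 / 4)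
    (u u1 u2 g : ℝ → ℝ) (hu : ∀ x, HasDerivAt u (u1 x) x) (hu1 : ∀ x, HasDerivAt u1 (u2 x) x)
    (hu2 : Continuous u2) (hpos : ∀ x, 0 ≤ u x) (ha : u a = 0) (ha1 : u1 a = 0)
    (hg : ContinuousOn g (Set.Icc a b)) (hg0 : ∀ x, 0 ≤ g x)
    (hineq : ∀ x ∈ Set.Icc a b, c * u x - g x / c ≤ h ^ 2 * u2 x) :
    (∫ x in a..A₁, u x) ≤ 16 * (Real.exp (-(κ * (b - A₁)) / h)) ^ 2 * (∫ x in a..b, u x)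
      + 32 / c ^ 2 * ∫ x in a..b, g x := by
  have hc0 : 0 < c := by rw [hc]; positivity
  have huc : Continuous u := continuous_iff_continuousAt.2 fun x => (hu x).continuousAt
  have hu1c : Continuous u1 := continuous_iff_continuousAt.2 fun x => (hu1 x).continuousAt
  set e := Real.exp (-(κ * (b - A₁)) / h) with he
  set σ : ℝ → ℝ := fun x => Real.sigmoid (κ * (A₁ - x) / h) with hσ
  have hσc : Continuous σ := by
    rw [hσ]; exact continuous_sigmoid.comp (by fun_prop)
  have hσ0 : ∀ x, 0 < σ x := fun x => Real.sigmoid_pos _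
  have hσ1 : ∀ x, σ x < 1 := fun x => Real.sigmoid_lt_one _
  have hσd : ∀ x, HasDerivAt σ (-(κ / h) * (σ x * (1 - σ x))) x := by
    intro x
    have h3 : HasDerivAt (fun x : ℝ => κ * (A₁ - x) / h) (κ * (-1) / h) x :=
      (((hasDerivAt_id x).const_sub A₁).const_mul κ).div_const h
    have := (Real.hasDerivAt_sigmoid (κ * (A₁ - x) / h)).comp x h3
    refine this.congr_deriv ?_
    ring
  have hanti : ∀ x y, x ≤ y → σ y ≤ σ x := by
    intro x y hxy
    apply Real.sigmoid_monotone
    gcongr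
  set s := σ b with hs
  have hse : s ≤ e := by
    have : s = (1 + Real.exp (-(κ * (A₁ - b) / h)))⁻¹ := rfl
    rw [this, he, show -(κ * (b - A₁)) / h = -(-(κ * (A₁ - b) / h)) by ring, Real.exp_neg (-(κ * (A₁ - b) / h))]
    have := Real.exp_pos (-(κ * (A₁ - b) / h))
    gcongr
    linarith
  have hs0 : 0 < s := hσ0 b
  have hse2 : s ^ 2 ≤ e ^ 2 := by gcongr
  set D : ℝ → ℝ := fun x => u1 x * (σ x - s) ^ 2 - u x * (2 * (σ x - s) * (-(κ / h) * (σ x * (1 - σ x)))) with hD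
  set D' : ℝ → ℝ := fun x => u2 x * (σ x - s) ^ 2 - u x * ((κ / h) ^ 2 *
    (2 * (σ x * (1 - σ x)) ^ 2 + 2 * (σ x - s) * (σ x * (1 - σ x) * (1 - 2 * σ x)))) with hD'
  have hDD : ∀ x, HasDerivAt D (D' x) x := by
    intro x
    have t := (hσd x).sub_const s
    have t1 := (hσd x).const_sub 1
    have := ((hu1 x).mul (t.pow 2)).sub ((hu x).mul ((t.const_mul 2).mul (((hσd x).mul t1).const_mul (-(κ / h)))))
    refine this.congr_deriv ?_
    simp only [hD', Nat.cast_ofNat, Pi.pow_apply, Pi.mul_apply]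
    ring
  have hD'c : Continuous D' := by rw [hD']; fun_prop
  have hint : ∫ x in a..b, D' x = 0 := by
    rw [intervalIntegral.integral_eq_sub_of_hasDerivAt (fun x _ => hDD x) (hD'c.intervalIntegrable _ _)]
    simp [hD, ha, ha1, ← hs]
  have hab : a ≤ b := by linarith
  have hgi : IntervalIntegrable g MeasureTheory.volume a b := by
    apply ContinuousOn.intervalIntegrable; rwa [Set.uIcc_of_le hab]
  have hui : ∀ p q, IntervalIntegrable u MeasureTheory.volume p q := fun p q => huc.intervalIntegrable _ _
  have hwc : Continuous (fun x => (σ x - s) ^ 2 * u x) := by fun_prop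
  have key : ∀ x ∈ Set.Icc a b, c / 2 * ((σ x - s) ^ 2 * u x) - c / 2 * s ^ 2 * u x - 1 / c * g x ≤ h ^ 2 * D' x := by
    intro x hx
    exact weight_alg (σ x) s c κ h (u x) (u2 x) (g x) hh hc hc0 (hpos x) (hg0 x) hs0 (hσ1 x)
      (hanti x b hx.2) (hineq x hx)
  have I1 := intervalIntegral.integral_mono_on hab
    ((((hwc.intervalIntegrable (μ := MeasureTheory.volume) a b).const_mul (c / 2)).sub ((hui a b).const_mul (c / 2 * s ^ 2))).sub (hgi.const_mul (1 / c)))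
    ((hD'c.intervalIntegrable (μ := MeasureTheory.volume) a b).const_mul (h ^ 2)) key
  rw [intervalIntegral.integral_sub (((hwc.intervalIntegrable a b).const_mul (c / 2)).sub ((hui a b).const_mul (c / 2 * s ^ 2))) (hgi.const_mul (1 / c)),
    intervalIntegral.integral_sub ((hwc.intervalIntegrable a b).const_mul (c / 2)) ((hui a b).const_mul (c / 2 * s ^ 2))] at I1
  simp only [intervalIntegral.integral_const_mul, hint] at I1
  have I2 : (∫ x in a..A₁, (σ x - s) ^ 2 * u x) ≤ ∫ x in a..b, (σ x - s) ^ 2 * u x := by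
    rw [← intervalIntegral.integral_add_adjacent_intervals (hwc.intervalIntegrable a A₁) (hwc.intervalIntegrable A₁ b)]
    have : 0 ≤ ∫ x in A₁..b, (σ x - s) ^ 2 * u x :=
      intervalIntegral.integral_nonneg h2.le (fun x _ => mul_nonneg (sq_nonneg _) (hpos x))
    linarith
  have I3 : (∫ x in a..A₁, 1 / 16 * u x) ≤ ∫ x in a..A₁, (σ x - s) ^ 2 * u x := by
    apply intervalIntegral.integral_mono_on h1.le ((hui _ _).const_mul _) (hwc.intervalIntegrable _ _)
    intro x hx
    have r1 : σ A₁ ≤ σ x := hanti _ _ hx.2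
    have r2 : σ A₁ = 1 / 2 := by simp [hσ, Real.sigmoid_zero]
    have := hpos x
    gcongr
    nlinarith
  rw [intervalIntegral.integral_const_mul] at I3
  have I4 : 0 ≤ ∫ x in a..b, u x := intervalIntegral.integral_nonneg hab (fun x _ => hpos x)
  have I5 : s ^ 2 * (∫ x in a..b, u x) ≤ e ^ 2 * ∫ x in a..b, u x := by gcongr
  have I6 : (∫ x in a..b, (σ x - s) ^ 2 * u x) ≤ s ^ 2 * (∫ x in a..b, u x) + 2 / c ^ 2 * ∫ x in a..b, g x := by
    have : c / 2 * (∫ x in a..b, (σ x - s) ^ 2 * u x) ≤ c / 2 * (s ^ 2 * (∫ x in a..b, u x) + 2 / c ^ 2 * ∫ x in a..b, g x) := by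
      have : c / 2 * (s ^ 2 * (∫ x in a..b, u x) + 2 / c ^ 2 * ∫ x in a..b, g x) = c / 2 * s ^ 2 * (∫ x in a..b, u x) + 1 / c * ∫ x in a..b, g x := by
        field_simp
      linarith
    exact le_of_mul_le_mul_left this (by positivity)
  have : 32 / c ^ 2 * (∫ x in a..b, g x) = 16 * (2 / c ^ 2 * ∫ x in a..b, g x) := by ring
  linarith

lemma abs_bilin (a b c d e f g k : ℝ) :
    |2 * (-a * d + b * c - e * k + f * g)| ≤
      a ^ 2 + b ^ 2 + c ^ 2 + d ^ 2 + e ^ 2 + f ^ 2 + g ^ 2 + k ^ 2 := by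
  rw [abs_le]
  constructor
  · linarith [sq_nonneg (a - d), sq_nonneg (b + c), sq_nonneg (e - k), sq_nonneg (f + g)]
  · linarith [sq_nonneg (a + d), sq_nonneg (b - c), sq_nonneg (e + k), sq_nonneg (f - g)]

set_option maxHeartbeats 1000000 in
/-- Pointwise coercivity of the matrix potential. -/
lemma pointwise_ineq (α β γ h c E : ℝ) (hc : 0 < c) (hα : c ≤ α - E - |β| - |γ|)
    (p q w : Fin 4 → ℂ) :
    c * nsq p - nsq ((-(h ^ 2 : ℂ)) • w + (((α : ℝ) : ℂ) • (1 : Matrix (Fin 4) (Fin 4) ℂ)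
      - (Complex.I * (β : ℂ)) • γ12 + (Complex.I * (γ : ℂ)) • γ1) *ᵥ p - (E : ℂ) • p) / c
    ≤ h ^ 2 * ∑ j, 2 * (Complex.normSq (q j) + ((p j).re * (w j).re + (p j).im * (w j).im)) := by
  set f := (-(h ^ 2 : ℂ)) • w + (((α : ℝ) : ℂ) • (1 : Matrix (Fin 4) (Fin 4) ℂ)
      - (Complex.I * (β : ℂ)) • γ12 + (Complex.I * (γ : ℂ)) • γ1) *ᵥ p - (E : ℂ) • p with hf
  have hre : ((h : ℂ) ^ 2).re = h ^ 2 := by rw [← Complex.ofReal_pow, Complex.ofReal_re]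
  have him : ((h : ℂ) ^ 2).im = 0 := by rw [← Complex.ofReal_pow, Complex.ofReal_im]
  have f0 : (f 0).re = -h^2 * (w 0).re + (α - E) * (p 0).re - β * (p 1).im - γ * (p 2).re ∧
     (f 0).im = -h^2 * (w 0).im + (α - E) * (p 0).im + β * (p 1).re - γ * (p 2).im := by
    constructor <;>
    simp [hf, Matrix.mulVec, dotProduct, Fin.sum_univ_four, γ1, γ12, hre, him, Matrix.one_apply] <;> ring
  have f1 : (f 1).re = -h^2 * (w 1).re + (α - E) * (p 1).re + β * (p 0).im + γ * (p 3).re ∧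
     (f 1).im = -h^2 * (w 1).im + (α - E) * (p 1).im - β * (p 0).re + γ * (p 3).im := by
    constructor <;>
    simp [hf, Matrix.mulVec, dotProduct, Fin.sum_univ_four, γ1, γ12, hre, him, Matrix.one_apply] <;> ring
  have f2 : (f 2).re = -h^2 * (w 2).re + (α - E) * (p 2).re - β * (p 3).im - γ * (p 0).re ∧
     (f 2).im = -h^2 * (w 2).im + (α - E) * (p 2).im + β * (p 3).re - γ * (p 0).im := by
    constructor <;>
    simp [hf, Matrix.mulVec, dotProduct, Fin.sum_univ_four, γ1, γ12, hre, him, Matrix.one_apply] <;> ring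
  have f3 : (f 3).re = -h^2 * (w 3).re + (α - E) * (p 3).re + β * (p 2).im + γ * (p 1).re ∧
     (f 3).im = -h^2 * (w 3).im + (α - E) * (p 3).im - β * (p 2).re + γ * (p 1).im := by
    constructor <;>
    simp [hf, Matrix.mulVec, dotProduct, Fin.sum_univ_four, γ1, γ12, hre, him, Matrix.one_apply] <;> ring
  clear_value f
  set X := 2 * (-(p 0).re * (p 1).im + (p 0).im * (p 1).re - (p 2).re * (p 3).im + (p 2).im * (p 3).re) with hX
  set Y := 2 * (-(p 0).re * (p 2).re - (p 0).im * (p 2).im + (p 1).re * (p 3).re + (p 1).im * (p 3).im) with hY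
  set R := ∑ j, ((p j).re * (f j).re + (p j).im * (f j).im) with hR
  have hXu : |X| ≤ nsq p := by
    have := abs_bilin (p 0).re (p 0).im (p 1).re (p 1).im (p 2).re (p 2).im (p 3).re (p 3).im
    simp only [hX, nsq, Fin.sum_univ_four, Complex.normSq_apply]
    refine le_trans (le_of_eq ?_) (this.trans (le_of_eq ?_)) <;> ring_nf
  have hYu : |Y| ≤ nsq p := by
    have := abs_bilin (p 0).re (p 0).im (-(p 2).im) (p 2).re (p 1).re (p 1).im (p 3).im (-(p 3).re)
    simp only [hY, nsq, Fin.sum_univ_four, Complex.normSq_apply]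
    refine le_trans (le_of_eq ?_) (this.trans (le_of_eq ?_)) <;> ring_nf
  have hu0 : 0 ≤ nsq p := Finset.sum_nonneg fun j _ => Complex.normSq_nonneg _
  have hq0 : 0 ≤ nsq q := Finset.sum_nonneg fun j _ => Complex.normSq_nonneg _
  have hid : h ^ 2 * ∑ j, 2 * (Complex.normSq (q j) + ((p j).re * (w j).re + (p j).im * (w j).im))
      = 2 * (h ^ 2 * nsq q) + 2 * ((α - E) * nsq p + β * X + γ * Y - R) := by
    simp only [hR, hX, hY, nsq, Fin.sum_univ_four, Complex.normSq_apply, f0.1, f0.2, f1.1, f1.2, f2.1, f2.2, f3.1, f3.2]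
    ring
  have hRb : 2 * R ≤ c * nsq p + nsq f / c := by
    have : ∀ j, 2 * ((p j).re * (f j).re + (p j).im * (f j).im) ≤ c * Complex.normSq (p j) + Complex.normSq (f j) / c := by
      intro j
      have e : c * Complex.normSq (p j) + Complex.normSq (f j) / c - 2 * ((p j).re * (f j).re + (p j).im * (f j).im)
        = ((c * (p j).re - (f j).re) ^ 2 + (c * (p j).im - (f j).im) ^ 2) / c := by
        simp only [Complex.normSq_apply]; field_simp; ring
      have : 0 ≤ ((c * (p j).re - (f j).re) ^ 2 + (c * (p j).im - (f j).im) ^ 2) / c := by positivity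
      linarith
    rw [hR, nsq, nsq, Finset.mul_sum, Finset.mul_sum, Finset.sum_div, ← Finset.sum_add_distrib]
    exact Finset.sum_le_sum fun j _ => this j
  have b1 : -(|β| * nsq p) ≤ β * X := by
    have := neg_abs_le (β * X)
    rw [abs_mul] at this
    have : |β| * |X| ≤ |β| * nsq p := by gcongr
    linarith
  have b2 : -(|γ| * nsq p) ≤ γ * Y := by
    have := neg_abs_le (γ * Y)
    rw [abs_mul] at this
    have : |γ| * |Y| ≤ |γ| * nsq p := by gcongr
    linarith
  have b3 : c * nsq p ≤ (α - E - |β| - |γ|) * nsq p := by gcongr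
  have b4 : 0 ≤ h ^ 2 * nsq q := by positivity
  rw [hid]
  linarith

lemma nsq_nonneg' (p : Fin 4 → ℂ) : 0 ≤ nsq p := Finset.sum_nonneg fun _ _ => Complex.normSq_nonneg _

lemma continuous_nsq' : Continuous nsq := by
  unfold nsq
  exact continuous_finsetSum _ fun j _ => Complex.continuous_normSq.comp (continuous_apply j)

lemma deriv_nsq (φ ψ : ℝ → Fin 4 → ℂ) (hφ : ∀ x, HasDerivAt φ (ψ x) x) (x : ℝ) :
    HasDerivAt (fun x => nsq (φ x))
      (∑ j, 2 * ((φ x j).re * (ψ x j).re + (φ x j).im * (ψ x j).im)) x := by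
  unfold nsq
  apply HasDerivAt.fun_sum
  intro j _
  have h1 := (hasDerivAt_pi.1 (hφ x)) j
  have hr : HasDerivAt (fun x => (φ x j).re) (ψ x j).re x := Complex.reCLM.hasFDerivAt.comp_hasDerivAt x h1
  have hi : HasDerivAt (fun x => (φ x j).im) (ψ x j).im x := Complex.imCLM.hasFDerivAt.comp_hasDerivAt x h1
  have := (hr.mul hr).add (hi.mul hi)
  simp only [Complex.normSq_apply]
  refine this.congr_deriv ?_
  ring

lemma deriv_nsq2 (φ ψ χ : ℝ → Fin 4 → ℂ) (hφ : ∀ x, HasDerivAt φ (ψ x) x)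
    (hψ : ∀ x, HasDerivAt ψ (χ x) x) (x : ℝ) :
    HasDerivAt (fun x => ∑ j, 2 * ((φ x j).re * (ψ x j).re + (φ x j).im * (ψ x j).im))
      (∑ j, 2 * (Complex.normSq (ψ x j) + ((φ x j).re * (χ x j).re + (φ x j).im * (χ x j).im))) x := by
  apply HasDerivAt.fun_sum
  intro j _
  have h1 := (hasDerivAt_pi.1 (hφ x)) j
  have hr : HasDerivAt (fun x => (φ x j).re) (ψ x j).re x := Complex.reCLM.hasFDerivAt.comp_hasDerivAt x h1
  have hi : HasDerivAt (fun x => (φ x j).im) (ψ x j).im x := Complex.imCLM.hasFDerivAt.comp_hasDerivAt x h1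
  have h1' := (hasDerivAt_pi.1 (hψ x)) j
  have hr' : HasDerivAt (fun x => (ψ x j).re) (χ x j).re x := Complex.reCLM.hasFDerivAt.comp_hasDerivAt x h1'
  have hi' : HasDerivAt (fun x => (ψ x j).im) (χ x j).im x := Complex.imCLM.hasFDerivAt.comp_hasDerivAt x h1'
  have := ((hr.mul hr').add (hi.mul hi')).const_mul 2
  simp only [Complex.normSq_apply]
  refine this.congr_deriv ?_
  ring

lemma cont_pot (α β γ : ℝ → ℝ) (s : Set ℝ) (hα : ContinuousOn α s) (hβ : ContinuousOn β s)
    (hγ : ContinuousOn γ s) (P Q : Matrix (Fin 4) (Fin 4) ℂ) :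
    ContinuousOn (fun x => ((α x : ℝ) : ℂ) • (1 : Matrix (Fin 4) (Fin 4) ℂ)
      - (Complex.I * (β x : ℂ)) • P + (Complex.I * (γ x : ℂ)) • Q) s := by
  have a1 : ContinuousOn (fun x => (α x : ℂ)) s := Complex.continuous_ofReal.comp_continuousOn hα
  have a2 : ContinuousOn (fun x => (β x : ℂ)) s := Complex.continuous_ofReal.comp_continuousOn hβ
  have a3 : ContinuousOn (fun x => (γ x : ℂ)) s := Complex.continuous_ofReal.comp_continuousOn hγ
  fun_prop

set_option maxHeartbeats 1000000 in
lemma agmon_matrix (a A₁ b h c κ E : ℝ) (h1 : a < A₁) (h2 : A₁ < b) (hh : 0 < h) (hκ0 : 0 < κ)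
    (hc0 : 0 < c)
    (hcκ : c = 16 * κ ^ 2) (hexp : Real.exp (-(κ * (b - A₁)) / h) ≤ 1 / 4)
    (α β γ : ℝ → ℝ) (cα : ContinuousOn α (Set.Icc a b)) (cβ : ContinuousOn β (Set.Icc a b))
    (cγ : ContinuousOn γ (Set.Icc a b))
    (hα : ∀ x ∈ Set.Icc a b, c ≤ α x - E - |β x| - |γ x|)
    (V : ℝ → Matrix (Fin 4) (Fin 4) ℂ)
    (hV : V = fun x => ((α x : ℝ) : ℂ) • (1 : Matrix (Fin 4) (Fin 4) ℂ)
      - (Complex.I * (β x : ℂ)) • γ12 + (Complex.I * (γ x : ℂ)) • γ1)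
    (φ : ℝ → Fin 4 → ℂ) (hφ : ContDiff ℝ (⊤ : ℕ∞) φ) (hφa : φ a = 0)
    (f : ℝ → Fin 4 → ℂ)
    (hf : f = fun x => (-(h^2 : ℂ)) • deriv (deriv φ) x + V x *ᵥ φ x - ((E : ℝ) : ℂ) • φ x) :
    (∫ x in a..A₁, nsq (φ x)) ≤
      16 * (Real.exp (-(κ * (b - A₁)) / h)) ^ 2 * (∫ x in a..b, nsq (φ x))
      + 32 / c ^ 2 * ∫ x in a..b, nsq (f x) := by
  have hd1 : ∀ x, HasDerivAt φ (deriv φ x) x := fun x =>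
    (hφ.differentiable (by simp) x).hasDerivAt
  have hφ' : ContDiff ℝ (⊤ : ℕ∞) (deriv φ) := by
    have : ContDiff ℝ ((⊤ : ℕ∞) + 1) φ := by simpa using hφ
    exact (contDiff_succ_iff_deriv.1 this).2.2
  have hφ'' : ContDiff ℝ (⊤ : ℕ∞) (deriv (deriv φ)) := by
    have : ContDiff ℝ ((⊤ : ℕ∞) + 1) (deriv φ) := by simpa using hφ'
    exact (contDiff_succ_iff_deriv.1 this).2.2
  have hd2 : ∀ x, HasDerivAt (deriv φ) (deriv (deriv φ) x) x := fun x =>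
    (hφ'.differentiable (by simp) x).hasDerivAt
  have cφ := hφ.continuous
  have cφ1 := hφ'.continuous
  have cφ2 := hφ''.continuous
  have hVc : ContinuousOn V (Set.Icc a b) := by
    rw [hV]; exact cont_pot α β γ _ cα cβ cγ _ _
  have hmvc : ContinuousOn (fun x => V x *ᵥ φ x) (Set.Icc a b) := by
    have : Continuous (fun z : Matrix (Fin 4) (Fin 4) ℂ × (Fin 4 → ℂ) => z.1 *ᵥ z.2) :=
      Continuous.matrix_mulVec continuous_fst continuous_snd
    exact this.comp_continuousOn (hVc.prodMk cφ.continuousOn)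
  have hfc : ContinuousOn f (Set.Icc a b) := by
    rw [hf]
    exact ((cφ2.const_smul (-(h^2 : ℂ))).continuousOn.add hmvc).sub (cφ.const_smul (E : ℂ)).continuousOn
  exact agmon_core a A₁ b h c κ h1 h2 hh hκ0 hcκ hexp (fun x => nsq (φ x)) _ _
    (fun x => nsq (f x)) (deriv_nsq φ _ hd1) (deriv_nsq2 φ _ _ hd1 hd2)
    (by
      have k0 : ∀ j, Continuous fun x => φ x j := fun j => (continuous_apply j).comp cφ
      have k1 : ∀ j, Continuous fun x => deriv φ x j := fun j => (continuous_apply j).comp cφ1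
      have k2 : ∀ j, Continuous fun x => deriv (deriv φ) x j := fun j => (continuous_apply j).comp cφ2
      apply continuous_finsetSum
      intro j _
      exact continuous_const.mul ((Complex.continuous_normSq.comp (k1 j)).add
        (((Complex.continuous_re.comp (k0 j)).mul (Complex.continuous_re.comp (k2 j))).add
        ((Complex.continuous_im.comp (k0 j)).mul (Complex.continuous_im.comp (k2 j))))))
    (fun x => nsq_nonneg' _) (by simp [hφa, nsq]) (by simp [hφa])
    (continuous_nsq'.comp_continuousOn hfc) (fun x => nsq_nonneg' _)
    (by
      intro x hx
      simp only [hf, hV]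
      exact pointwise_ineq _ _ _ h c E hc0 (hα x hx) (φ x) (deriv φ x) (deriv (deriv φ) x))

set_option maxHeartbeats 1000000 in
/-- Tunneling estimate: with `Σ₁ = [x₊,A₁)`, `Σ₂ = [x₊,A₂)`,
`A₁ < A₂ < x_S` where `A(x_S)² = 1/l² + S`, there are `h₀, C, ε > 0` such
that for `0 < h < h₀`, `E < 1/l² + S` and every `φ ∈ C_c^∞((x₊,0),ℂ⁴)`:
`‖φ‖_{L²(Σ₁)} ≤ C(e^{−ε/h}‖φ‖_{L²(Σ₂)} + ‖−h²φ'' + Vφ − Eφ‖_{L²(Σ₂)})`. -/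
theorem stmt_17 (M l : ℝ) (hM : 0 < M) (hl : 0 < l)
    (rSAdS : ℝ) (hrS : 0 < rSAdS) (hroot : F M l rSAdS = 0)
    (hFpos : ∀ r, rSAdS < r → 0 < F M l r)
    (rfun : ℝ → ℝ)
    (hrange : ∀ x, x < 0 → rSAdS < rfun x)
    (hinv1 : ∀ x, x < 0 → -(∫ s in Set.Ioi (rfun x), (F M l s)⁻¹) = x)
    (hinv2 : ∀ r, rSAdS < r → rfun (-(∫ s in Set.Ioi r, (F M l s)⁻¹)) = r)
    (hAsm : ContDiffOn ℝ (⊤ : ℕ∞) (A M l rfun) (Set.Iio 0))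
    (hBsm : ContDiffOn ℝ (⊤ : ℕ∞) (B M l rfun) (Set.Iio 0))
    (m : ℝ) (hm : 0 < m)
    (xp : ℝ) (hxp : xp < 0)
    (hA' : ∀ x, xp ≤ x → x < 0 → deriv (A M l rfun) x < 0)
    (hcond : ∀ r, rfun xp ≤ r → 0 ≤ F M l r / (4*l^2) - (F' M l r)^2 / 16)
    (S : ℝ) (hS : 0 < S) (hSA : 1/l^2 + S < (A M l rfun xp)^2)
    (xS : ℝ) (hxS : xS ∈ Set.Ioo xp (0:ℝ))
    (hxSeq : (A M l rfun xS)^2 = 1/l^2 + S)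
    (hxSuniq : ∀ y ∈ Set.Ioo xp (0:ℝ), (A M l rfun y)^2 = 1/l^2 + S → y = xS)
    (A₁ A₂ : ℝ) (hA₁ : xp < A₁) (hA₁₂ : A₁ < A₂) (hA₂ : A₂ < xS) :
    ∃ h₀ > 0, ∃ C > 0, ∃ ε > 0, ∀ h : ℝ, 0 < h → h < h₀ →
      ∀ E : ℝ, E < 1/l^2 + S →
      ∀ φ : ℝ → Fin 4 → ℂ, ContDiff ℝ (⊤ : ℕ∞) φ → HasCompactSupport φ →
        tsupport φ ⊆ Set.Ioo xp 0 →
        L2norm (Set.Ico xp A₁) φ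
          ≤ C * (Real.exp (-ε/h) * L2norm (Set.Ico xp A₂) φ
              + L2norm (Set.Ico xp A₂)
                  (fun x => (-(h^2 : ℂ)) • deriv (deriv φ) x
                    + Vpot M l rfun m h x *ᵥ φ x
                    - ((E : ℝ) : ℂ) • φ x)) := by
  have hxS0 : xS < 0 := hxS.2
  have hA20 : A₂ < 0 := hA₂.trans hxS0
  have hAc : ContinuousOn (A M l rfun) (Set.Iio 0) := hAsm.continuousOn
  have hBc : ContinuousOn (B M l rfun) (Set.Iio 0) := hBsm.continuousOn
  have hA'c : ContinuousOn (deriv (A M l rfun)) (Set.Iio 0) :=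
    hAsm.continuousOn_deriv_of_isOpen isOpen_Iio (by simp)
  have hB'c : ContinuousOn (deriv (B M l rfun)) (Set.Iio 0) :=
    hBsm.continuousOn_deriv_of_isOpen isOpen_Iio (by simp)
  have hsub : Set.Icc xp A₂ ⊆ Set.Iio 0 := fun x hx => lt_of_le_of_lt hx.2 hA20
  have hanti : StrictAntiOn (A M l rfun) (Set.Icc xp xS) := by
    apply strictAntiOn_of_deriv_neg (convex_Icc _ _)
    · exact hAc.mono fun x hx => lt_of_le_of_lt hx.2 hxS0
    · intro x hx
      rw [interior_Icc] at hx
      exact hA' x hx.1.le (hx.2.trans hxS0)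
  have hApos : ∀ x, x < 0 → 0 ≤ A M l rfun x := fun x hx =>
    div_nonneg (Real.sqrt_nonneg _) (hrS.trans (hrange x hx)).le
  obtain ⟨K₁, hK₁⟩ := isCompact_Icc.exists_bound_of_continuousOn (hA'c.mono hsub)
  obtain ⟨K₂, hK₂⟩ := isCompact_Icc.exists_bound_of_continuousOn (hB'c.mono hsub)
  have hA2mem : A₂ ∈ Set.Icc xp xS := ⟨by linarith, hA₂.le⟩
  have hlt : A M l rfun xS < A M l rfun A₂ := hanti hA2mem ⟨hxS.1.le, le_refl _⟩ hA₂
  have hlt2 : (A M l rfun xS) ^ 2 < (A M l rfun A₂) ^ 2 := by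
    have := hApos xS hxS0
    gcongr
  set δ := (A M l rfun A₂) ^ 2 - (A M l rfun xS) ^ 2 with hδ
  have hδ0 : 0 < δ := sub_pos.2 hlt2
  set c := δ / 2 with hcdef
  have hc0 : 0 < c := by positivity
  set κ := Real.sqrt c / 4 with hκdef
  have hκ0 : 0 < κ := by positivity
  have hcκ : c = 16 * κ ^ 2 := by
    rw [hκdef, div_pow, Real.sq_sqrt hc0.le]; ring
  set ε := κ * (A₂ - A₁) with hε
  have hε0 : 0 < ε := mul_pos hκ0 (by linarith)
  have hK10 : 0 ≤ K₁ := (norm_nonneg _).trans (hK₁ A₂ ⟨by linarith, le_refl _⟩)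
  have hK20 : 0 ≤ K₂ := (norm_nonneg _).trans (hK₂ A₂ ⟨by linarith, le_refl _⟩)
  refine ⟨min 1 (min (ε / 3) (c / (K₁ + m * K₂ + 1))), by positivity, 4 + 6 / c, by positivity, ε, hε0, ?_⟩
  intro h hh hhlt E hE φ hφ hφc hφs
  have hh1 : h < 1 := hhlt.trans_le (min_le_left _ _)
  have hh2 : h < ε / 3 := hhlt.trans_le ((min_le_right _ _).trans (min_le_left _ _))
  have hh3 : h < c / (K₁ + m * K₂ + 1) := hhlt.trans_le ((min_le_right _ _).trans (min_le_right _ _))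
  have hh4 : h * (K₁ + m * K₂ + 1) < c := by rwa [lt_div_iff₀ (by positivity)] at hh3
  have hh5 : h * K₁ + h * (m * K₂) < c := by linarith
  have hexp : Real.exp (-ε / h) ≤ 1 / 4 := by
    have e1 : 3 ≤ ε / h := by rw [le_div_iff₀ hh]; linarith
    have e2 := Real.add_one_le_exp (ε / h)
    rw [neg_div, Real.exp_neg, one_div]
    gcongr
    linarith
  have hφxp : φ xp = 0 := by
    apply image_eq_zero_of_notMem_tsupport
    intro hx
    exact lt_irrefl _ (hφs hx).1
  set f : ℝ → Fin 4 → ℂ := fun x => (-(h^2 : ℂ)) • deriv (deriv φ) x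
                    + Vpot M l rfun m h x *ᵥ φ x
                    - ((E : ℝ) : ℂ) • φ x with hf
  have a1 := hAc.mono hsub
  have a2 := hBc.mono hsub
  have a3 := hA'c.mono hsub
  have a4 := hB'c.mono hsub
  have main := agmon_matrix xp A₁ A₂ h c κ E hA₁ hA₁₂ hh hκ0 hc0 hcκ hexp
    (fun x => (A M l rfun x) ^ 2 + h ^ 2 * m ^ 2 * (B M l rfun x) ^ 2)
    (fun x => h * deriv (A M l rfun) x) (fun x => h ^ 2 * m * deriv (B M l rfun) x)
    ((a1.pow 2).add (continuousOn_const.mul (a2.pow 2))) (continuousOn_const.mul a3)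
    (continuousOn_const.mul a4)
    (by
      intro x hx
      have b1 := hK₁ x hx
      have b2 := hK₂ x hx
      rw [Real.norm_eq_abs] at b1 b2
      have b3 : A M l rfun A₂ ≤ A M l rfun x :=
        hanti.antitoneOn ⟨hx.1, hx.2.trans hA₂.le⟩ hA2mem hx.2
      have b4 : (A M l rfun A₂) ^ 2 ≤ (A M l rfun x) ^ 2 := by
        have := hApos A₂ hA20
        gcongr
      have b5 : |h * deriv (A M l rfun) x| ≤ h * K₁ := by
        rw [abs_mul, abs_of_pos hh]; gcongr
      have b6 : |h ^ 2 * m * deriv (B M l rfun) x| ≤ h * (m * K₂) := by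
        rw [abs_mul, abs_of_pos (by positivity), mul_assoc]
        have : h ^ 2 ≤ h := by nlinarith
        gcongr
      have b7 : 0 ≤ h ^ 2 * m ^ 2 * (B M l rfun x) ^ 2 := by positivity
      have b8 : δ = 2 * c := by rw [hcdef]; ring
      linarith)
    (Vpot M l rfun m h) rfl φ hφ hφxp f hf
  have conv : ∀ (b : ℝ) (g : ℝ → Fin 4 → ℂ), xp < b → L2norm (Set.Ico xp b) g = Real.sqrt (∫ x in xp..b, nsq (g x)) := by
    intro b g hb
    rw [L2norm, integral_Ico_eq_integral_Ioc, intervalIntegral.integral_of_le hb.le]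
  rw [conv A₁ φ hA₁, conv A₂ φ (by linarith), conv A₂ f (by linarith)]
  set e := Real.exp (-ε / h) with he
  have he0 : 0 < e := Real.exp_pos _
  have U0 : 0 ≤ ∫ x in xp..A₂, nsq (φ x) :=
    intervalIntegral.integral_nonneg (by linarith) (fun x _ => nsq_nonneg' _)
  have G0 : 0 ≤ ∫ x in xp..A₂, nsq (f x) :=
    intervalIntegral.integral_nonneg (by linarith) (fun x _ => nsq_nonneg' _)
  set U := ∫ x in xp..A₂, nsq (φ x)
  set G := ∫ x in xp..A₂, nsq (f x)
  have sU := Real.sq_sqrt U0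
  have sG := Real.sq_sqrt G0
  have pU := Real.sqrt_nonneg U
  have pG := Real.sqrt_nonneg G
  have step : Real.sqrt (∫ x in xp..A₁, nsq (φ x)) ≤ 4 * (e * Real.sqrt U) + 6 / c * Real.sqrt G := by
    apply Real.sqrt_le_iff.2
    refine ⟨by positivity, main.trans ?_⟩
    have t1 : 0 ≤ (4 * (e * Real.sqrt U)) * (6 / c * Real.sqrt G) := by positivity
    have t2 : (4 * (e * Real.sqrt U)) ^ 2 = 16 * e ^ 2 * U := by rw [mul_pow, mul_pow, sU]; ring
    have t3 : (6 / c * Real.sqrt G) ^ 2 = 36 / c ^ 2 * G := by rw [mul_pow, sG, div_pow]; norm_num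
    have t4 : 32 / c ^ 2 * G ≤ 36 / c ^ 2 * G := by gcongr; norm_num
    rw [add_sq, t2, t3]
    linarith
  have t6 : 0 ≤ 6 / c * (e * Real.sqrt U) := by positivity
  have t7 : 0 ≤ 4 * Real.sqrt G := by positivity
  nlinarith
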